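/- Let (Ω, 𝔽, ℙ) be a probability space, ψ⁺ ≥ 0 and ψ⁻ ≥ 0 penalties, w ∈ [0,1], and let ŷ₁, …, ŷ_m and Y₁, …, Y_m be real random variables such that each c(ŷ_i, Y_i) is integrable and ∑_{j=1}^m c(ŷ_j, Y_j) > 0 almost surely. Under bottom-up reconciliation with the proportional-cost shares γ_i^pc = c(ŷ_i, Y_i) / ∑_j c(ŷ_j, Y_j), the expected allocated cost of each producer does not exceed its expected independent cost: E[(1 − w)·c(ŷ_i, Y_i) + w·γ_i^pc·c(∑_j ŷ_j, ∑_j Y_j)] ≤ E[c(ŷ_i, Y_i)] for every i. In particular, the agreement set of the Nash bargaining problem is non-empty. -/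

import Mathlib

open MeasureTheory

/-- Imbalance cost of an offer `q` against a realization `y`. -/
noncomputable def imbalanceCost (ψp ψm q y : ℝ) : ℝ :=
  ψp * max (y - q) 0 + ψm * max (q - y) 0

theorem imbalanceCost_nonneg {ψp ψm : ℝ} (hψp : 0 ≤ ψp) (hψm : 0 ≤ ψm) (q y : ℝ) :
    0 ≤ imbalanceCost ψp ψm q y := by
  unfold imbalanceCost
  positivity

theorem max_sum_sub_sum_zero_le {ι : Type*} (s : Finset ι) (a b : ι → ℝ) :
    max (∑ j ∈ s, a j - ∑ j ∈ s, b j) 0 ≤ ∑ j ∈ s, max (a j - b j) 0 := by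
  rw [← Finset.sum_sub_distrib]
  exact max_le (Finset.sum_le_sum fun _ _ => le_max_left _ _)
    (Finset.sum_nonneg fun _ _ => le_max_right _ _)

/-- The imbalance cost is subadditive: aggregation never increases the total cost. -/
theorem imbalanceCost_sum_le {ι : Type*} {ψp ψm : ℝ} (hψp : 0 ≤ ψp) (hψm : 0 ≤ ψm)
    (s : Finset ι) (q y : ι → ℝ) :
    imbalanceCost ψp ψm (∑ j ∈ s, q j) (∑ j ∈ s, y j) ≤
      ∑ j ∈ s, imbalanceCost ψp ψm (q j) (y j) := by
  unfold imbalanceCost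
  rw [Finset.sum_add_distrib, ← Finset.mul_sum, ← Finset.mul_sum]
  exact add_le_add (mul_le_mul_of_nonneg_left (max_sum_sub_sum_zero_le s y q) hψp)
    (mul_le_mul_of_nonneg_left (max_sum_sub_sum_zero_le s q y) hψm)

/-- Under bottom-up reconciliation with proportional-cost shares, the expected allocated
cost of each producer does not exceed its expected independent cost; in particular the
agreement set of the Nash bargaining problem is non-empty. -/
theorem expected_allocated_cost_le_expected_independent_cost
    {Ω : Type*} [MeasurableSpace Ω] (P : Measure Ω) [IsProbabilityMeasure P]
    (ψp ψm : ℝ) (hψp : 0 ≤ ψp) (hψm : 0 ≤ ψm)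
    (w : ℝ) (hw0 : 0 ≤ w) (hw1 : w ≤ 1)
    (m : ℕ) (yhat Y : Fin m → Ω → ℝ)
    (hint : ∀ i, Integrable (fun ω => imbalanceCost ψp ψm (yhat i ω) (Y i ω)) P)
    (hpos : ∀ᵐ ω ∂P, 0 < ∑ j, imbalanceCost ψp ψm (yhat j ω) (Y j ω)) :
    ∀ i, (∫ ω, ((1 - w) * imbalanceCost ψp ψm (yhat i ω) (Y i ω) +
          w * (imbalanceCost ψp ψm (yhat i ω) (Y i ω) /
              ∑ j, imbalanceCost ψp ψm (yhat j ω) (Y j ω)) *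
            imbalanceCost ψp ψm (∑ j, yhat j ω) (∑ j, Y j ω)) ∂P) ≤
      ∫ ω, imbalanceCost ψp ψm (yhat i ω) (Y i ω) ∂P := by
  intro i
  have hc := imbalanceCost_nonneg hψp hψm
  refine integral_mono_of_nonneg (Filter.Eventually.of_forall fun ω => ?_) (hint i) ?_
  · exact add_nonneg (mul_nonneg (sub_nonneg.2 hw1) (hc _ _))
      (mul_nonneg (mul_nonneg hw0 (div_nonneg (hc _ _) (Finset.sum_nonneg fun _ _ => hc _ _)))
        (hc _ _))
  · filter_upwards [hpos] with ω hω
    have hshare : imbalanceCost ψp ψm (yhat i ω) (Y i ω) /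
        (∑ j, imbalanceCost ψp ψm (yhat j ω) (Y j ω)) *
          imbalanceCost ψp ψm (∑ j, yhat j ω) (∑ j, Y j ω) ≤
        imbalanceCost ψp ψm (yhat i ω) (Y i ω) :=
      (mul_le_mul_of_nonneg_left
        (imbalanceCost_sum_le hψp hψm Finset.univ (fun j => yhat j ω) fun j => Y j ω)
        (div_nonneg (hc _ _) hω.le)).trans_eq (div_mul_cancel₀ _ hω.ne')
    rw [mul_assoc w]
    linarith [mul_le_mul_of_nonneg_left hshare hw0]
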